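/- Let ρ ∈ [0,1]. Suppose there exists a map assigning to every countable collection 𝓛 : ℕ → Set ℕ (each 𝓛 i infinite) a function G_vanilla(𝓛) : List ℕ → ℕ such that for every index i and every injective sequence x : ℕ → ℕ with range exactly 𝓛 i (an enumeration without noise or omissions), there is n* with G_vanilla(𝓛)(x_1,…,x_n) ∈ 𝓛 i \ {x_1,…,x_n} for all n ≥ n*, and the output set W := {G_vanilla(𝓛)(x_1,…,x_n) : n ∈ ℕ} satisfies μ_low(W, 𝓛 i) ≥ ρ. Then there exists a map G_tolerant of the same type such that for every countable collection 𝓛, every index i, and every enumeration x of K := 𝓛 i with finite noise and finite omissions, there is n* with G_tolerant(𝓛)(x_1,…,x_n) ∈ K \ {x_1,…,x_n} for all n ≥ n*, and the output set W satisfies μ_low(W, K) ≥ ρ. -/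

import Mathlib

open Filter Set Topology

/-- The list `[x 0, …, x (n-1)]` of the first `n` elements of the stream `x`
(the paper's `x_1, …, x_n`). -/
def prefixList (x : ℕ → ℕ) (n : ℕ) : List ℕ := (List.range n).map x

/-- The set of the first `n` elements of the stream `x` (the paper's `{x_1, …, x_n}`). -/
def seen (x : ℕ → ℕ) (n : ℕ) : Set ℕ := x '' {t | t < n}

/-- The empirical noise rate `R(L; x_{1:n})` of the first `n` elements of `x` w.r.t. `L`. -/
noncomputable def noiseRate (L : Set ℕ) (x : ℕ → ℕ) (n : ℕ) : ℝ :=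
  (({t | t < n ∧ x t ∉ L}).ncard : ℝ) / n

/-- `|A ∩ {b_1, …, b_m}| / m` where `b_1 < b_2 < …` is the increasing enumeration of `B`. -/
noncomputable def densityRatio (A B : Set ℕ) (m : ℕ) : ℝ :=
  (({j | j < m ∧ Nat.nth (· ∈ B) j ∈ A}).ncard : ℝ) / m

/-- Lower density `μ_low(A, B)` of `A` in `B`. -/
noncomputable def lowDensity (A B : Set ℕ) : ℝ := Filter.liminf (densityRatio A B) Filter.atTop

/-- Upper density `μ_up(A, B)` of `A` in `B`. -/
noncomputable def upDensity (A B : Set ℕ) : ℝ := Filter.limsup (densityRatio A B) Filter.atTop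

/-- All languages obtained from the collection `𝓛` by adding finitely many elements and then
removing finitely many elements. -/
def finiteModifications (𝓛 : ℕ → Set ℕ) (n : ℕ) : Set ℕ :=
  let p := (Denumerable.eqv (ℕ × Finset ℕ × Finset ℕ)).symm n
  (𝓛 p.1 ∪ p.2.1) \ p.2.2

lemma finiteModifications_infinite {𝓛 : ℕ → Set ℕ} (h𝓛 : ∀ i, (𝓛 i).Infinite) (n : ℕ) :
    (finiteModifications 𝓛 n).Infinite :=
  ((h𝓛 _).mono subset_union_left).sdiff (Finset.finite_toSet _)

lemma exists_finiteModifications_eq (𝓛 : ℕ → Set ℕ) (i : ℕ) {X : Set ℕ}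
    (hn : (X \ 𝓛 i).Finite) (ho : (𝓛 i \ X).Finite) :
    ∃ n, finiteModifications 𝓛 n = X := by
  obtain ⟨n, hn'⟩ := (Denumerable.eqv (ℕ × Finset ℕ × Finset ℕ)).symm.surjective
    (i, hn.toFinset, ho.toFinset)
  refine ⟨n, ?_⟩
  rw [finiteModifications, hn']
  ext a
  simp only [Set.Finite.coe_toFinset, Set.mem_sdiff, Set.mem_union]
  tauto

open Classical in
lemma ncard_nth_mem_count (A B : Set ℕ) (N : ℕ) :
    {j | j < Nat.count (· ∈ B) N ∧ Nat.nth (· ∈ B) j ∈ A}.ncard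
      = Nat.count (· ∈ A ∩ B) N := by
  have key : ∀ M, Nat.count (fun j => Nat.nth (· ∈ B) j ∈ A) (Nat.count (· ∈ B) M)
      = Nat.count (· ∈ A ∩ B) M := by
    intro M
    induction M with
    | zero => simp
    | succ M ih =>
      by_cases hB : M ∈ B
      · have hM : Nat.nth (· ∈ B) (Nat.count (· ∈ B) M) = M :=
          Nat.nth_count (p := (· ∈ B)) hB
        rw [Nat.count_succ, if_pos hB, Nat.count_succ, ih, hM, Nat.count_succ]
        simp [hB]
      · rw [Nat.count_succ, if_neg hB, add_zero, ih, Nat.count_succ]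
        simp [hB]
  have hset : {j | j < Nat.count (· ∈ B) N ∧ Nat.nth (· ∈ B) j ∈ A}
      = ({j ∈ Finset.range (Nat.count (· ∈ B) N) | Nat.nth (· ∈ B) j ∈ A} : Finset ℕ) := by
    ext j
    simp
  rw [← key, hset, Set.ncard_coe_finset, Nat.count_eq_card_filter_range _ (Nat.count _ N)]

lemma count_le_count_add_card {A B : Set ℕ} [DecidablePred (· ∈ A)] [DecidablePred (· ∈ B)]
    {D : Finset ℕ} (h : A \ B ⊆ D) (N : ℕ) :
    Nat.count (· ∈ A) N ≤ Nat.count (· ∈ B) N + D.card := by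
  rw [Nat.count_eq_card_filter_range, Nat.count_eq_card_filter_range]
  refine (Finset.card_le_card fun a ha => ?_).trans (Finset.card_union_le _ D)
  simp only [Finset.mem_filter, Finset.mem_union, Finset.mem_range] at ha ⊢
  by_cases hB : a ∈ B
  · exact Or.inl ⟨ha.1, hB⟩
  · exact Or.inr (h ⟨ha.2, hB⟩)

lemma densityRatio_nonneg (A B : Set ℕ) (m : ℕ) : 0 ≤ densityRatio A B m := by
  unfold densityRatio
  positivity

lemma densityRatio_le_one (A B : Set ℕ) (m : ℕ) : densityRatio A B m ≤ 1 := by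
  refine div_le_one_of_le₀ ?_ (Nat.cast_nonneg m)
  have h : {j | j < m ∧ Nat.nth (· ∈ B) j ∈ A}.ncard ≤ (Set.Iio m).ncard :=
    Set.ncard_le_ncard (fun j hj => hj.1) (Set.finite_Iio m)
  have hm : (Set.Iio m).ncard = m := by
    rw [← Finset.coe_Iio, Set.ncard_coe_finset, Nat.card_Iio]
  exact_mod_cast hm ▸ h

open Classical in
/-- Lower density in an infinite set does not decrease under finite changes of that set. -/
lemma lowDensity_le_of_finite_sdiff (A : Set ℕ) {B C : Set ℕ} (hB : B.Infinite)
    (hBC : (B \ C).Finite) (hCB : (C \ B).Finite) :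
    lowDensity A C ≤ lowDensity A B := by
  obtain ⟨D, hD₁, hD₂⟩ : ∃ D : Finset ℕ, B \ C ⊆ D ∧ C \ B ⊆ D :=
    ⟨(hBC.union hCB).toFinset, by simp, by simp⟩
  refine le_of_forall_pos_sub_le fun ε hε => ?_
  set r := lowDensity A C - ε / 2 with hr
  have hev : ∀ᶠ m in atTop, r < densityRatio A C m :=
    eventually_lt_of_lt_liminf (by change r < lowDensity A C; linarith)
      (isBoundedUnder_of ⟨0, densityRatio_nonneg A C⟩)
  obtain ⟨M, hM⟩ := eventually_atTop.1 hev
  obtain ⟨T, hT⟩ := exists_nat_gt ((|r| + 1) * D.card / (ε / 2))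
  refine le_liminf_of_le
    (isBoundedUnder_of ⟨1, densityRatio_le_one A B⟩).isCoboundedUnder_ge ?_
  filter_upwards [eventually_ge_atTop (M + D.card + T + 1)] with m hm
  set N := Nat.nth (· ∈ B) m
  have hmN : Nat.count (· ∈ B) N = m := Nat.count_nth_of_infinite (p := (· ∈ B)) hB m
  set k := Nat.count (· ∈ C) N with hk
  have h₁ : m ≤ k + D.card := hmN ▸ count_le_count_add_card hD₁ N
  have h₂ : k ≤ m + D.card := hmN ▸ count_le_count_add_card hD₂ N
  have h₃ : Nat.count (· ∈ A ∩ C) N ≤ Nat.count (· ∈ A ∩ B) N + D.card :=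
    count_le_count_add_card (A := A ∩ C) (B := A ∩ B)
      (fun a ha => hD₂ ⟨ha.1.2, fun h => ha.2 ⟨ha.1.1, h⟩⟩) N
  have hkpos : (0 : ℝ) < k := by exact_mod_cast (by omega : 0 < k)
  have hmpos : (0 : ℝ) < m := by exact_mod_cast (by omega : 0 < m)
  have hC := hM k (by omega)
  rw [densityRatio, hk, ncard_nth_mem_count, ← hk, lt_div_iff₀ hkpos] at hC
  rw [densityRatio, ← hmN, ncard_nth_mem_count, hmN, le_div_iff₀ hmpos]
  have hTm : (|r| + 1) * D.card ≤ m * (ε / 2) := by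
    rw [div_lt_iff₀ (by positivity)] at hT
    have : (T : ℝ) ≤ m := by exact_mod_cast (by omega : T ≤ m)
    nlinarith
  have hmk : |(m : ℝ) - k| ≤ D.card := by
    have h₁' : (m : ℝ) ≤ k + D.card := by exact_mod_cast h₁
    have h₂' : (k : ℝ) ≤ m + D.card := by exact_mod_cast h₂
    exact abs_le.2 ⟨by linarith, by linarith⟩
  have hrmk : r * (m - k) ≤ |r| * D.card :=
    (le_abs_self _).trans (abs_mul r _ ▸ mul_le_mul_of_nonneg_left hmk (abs_nonneg r))
  have h₃' : (Nat.count (· ∈ A ∩ C) N : ℝ) ≤ Nat.count (· ∈ A ∩ B) N + D.card := by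
    exact_mod_cast h₃
  have hsplit : (lowDensity A C - ε) * m = r * k + r * (m - k) - m * (ε / 2) := by
    rw [hr]; ring
  linarith

lemma exists_subset_seen {x : ℕ → ℕ} {S : Set ℕ} (hS : S.Finite) (hSx : S ⊆ Set.range x) :
    ∃ n₀, ∀ n ≥ n₀, S ⊆ seen x n := by
  have h : ∀ a ∈ S, ∃ j, x j = a := fun a ha => hSx ha
  choose! t ht using h
  obtain ⟨b, hb⟩ := (hS.image t).bddAbove
  exact ⟨b + 1, fun n hn a ha =>
    ⟨t a, (hb (Set.mem_image_of_mem t ha)).trans_lt (Nat.lt_of_succ_le hn), ht a ha⟩⟩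

/-- Element-based density under finite contamination is as achievable as without
contamination: any universal noiseless element-based density-`ρ` generator can be
converted to one tolerating finite noise and finite omissions. -/
theorem element_based_density_finite_contamination
    (ρ : ℝ) (hρ : ρ ∈ Set.Icc (0:ℝ) 1)
    (Gvanilla : (ℕ → Set ℕ) → List ℕ → ℕ)
    (hvanilla : ∀ 𝓛 : ℕ → Set ℕ, (∀ i, (𝓛 i).Infinite) →
      ∀ i : ℕ, ∀ x : ℕ → ℕ, Function.Injective x → Set.range x = 𝓛 i →
        (∃ nstar : ℕ, ∀ n ≥ nstar, Gvanilla 𝓛 (prefixList x n) ∈ 𝓛 i \ seen x n) ∧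
        lowDensity (Set.range fun n => Gvanilla 𝓛 (prefixList x n)) (𝓛 i) ≥ ρ) :
    ∃ Gtol : (ℕ → Set ℕ) → List ℕ → ℕ,
      ∀ 𝓛 : ℕ → Set ℕ, (∀ i, (𝓛 i).Infinite) →
      ∀ i : ℕ, ∀ x : ℕ → ℕ, Function.Injective x →
        (Set.range x \ 𝓛 i).Finite → (𝓛 i \ Set.range x).Finite →
        (∃ nstar : ℕ, ∀ n ≥ nstar, Gtol 𝓛 (prefixList x n) ∈ 𝓛 i \ seen x n) ∧
        lowDensity (Set.range fun n => Gtol 𝓛 (prefixList x n)) (𝓛 i) ≥ ρ := by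
  refine ⟨fun 𝓛 => Gvanilla (finiteModifications 𝓛), fun 𝓛 h𝓛 i x hx hn ho => ?_⟩
  obtain ⟨k, hk⟩ := exists_finiteModifications_eq 𝓛 i hn ho
  obtain ⟨⟨n₁, h₁⟩, hρW⟩ := hvanilla (finiteModifications 𝓛)
    (finiteModifications_infinite h𝓛) k x hx hk.symm
  rw [hk] at h₁ hρW
  obtain ⟨n₀, h₀⟩ := exists_subset_seen hn Set.sdiff_subset
  refine ⟨⟨max n₀ n₁, fun n hmax => ?_⟩,
    hρW.le.trans (lowDensity_le_of_finite_sdiff _ (h𝓛 i) ho hn)⟩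
  obtain ⟨hmem, hnew⟩ := h₁ n (le_of_max_le_right hmax)
  refine ⟨by_contra fun h => hnew (h₀ n (le_of_max_le_left hmax) ⟨hmem, h⟩), hnew⟩
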